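/- arXiv:1902.06776 — 7 statements merged into one kernel-verified Lean document; each statement's English description precedes it below -/
import Mathlib

section
/- Let σ be a state such that (i) for every register set r, any two values decided in register set r at σ are equal, and (ii) for all register sets r < r', if a value v is decided in register set r at σ and σ s r' = some (some v') for some server s, then v = v'. Then any two values decided at σ, in arbitrary register sets, are equal. -/
/-- `Decided 𝒬 σ r v`: the value `v` is decided in register set `r` at state
`σ`, i.e. some quorum `Q ∈ 𝒬 r` has `σ s r = some (some v)` for all `s ∈ Q`. -/
def Decided {S V : Type*} (𝒬 : ℕ → Set (Set S))
    (σ : S → ℕ → Option (Option V)) (r : ℕ) (v : V) : Prop :=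
  ∃ Q ∈ 𝒬 r, ∀ s ∈ Q, σ s r = some (some v)

/-- Agreement needs no assumption that quorums are non-empty: an empty quorum in `𝒬 r` makes every
value decided in register set `r`, so that agreement within `r` already identifies all values. -/
theorem Decided.agree {S V : Type*} {𝒬 : ℕ → Set (Set S)} {σ : S → ℕ → Option (Option V)}
    (hsame : ∀ r (v v' : V), Decided 𝒬 σ r v → Decided 𝒬 σ r v' → v = v')
    (hprev : ∀ r r', r < r' → ∀ (v : V), Decided 𝒬 σ r v →
      ∀ (s : S) (v' : V), σ s r' = some (some v') → v = v')
    {r r' : ℕ} {v v' : V} (hv : Decided 𝒬 σ r v) (hv' : Decided 𝒬 σ r' v') : v = v' := by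
  have key : ∀ {a b : ℕ} {x y : V}, a < b → Decided 𝒬 σ a x → Decided 𝒬 σ b y → x = y := by
    intro a b x y hab hx hy
    obtain ⟨Q, hQ, hσ⟩ := hy
    rcases Q.eq_empty_or_nonempty with rfl | ⟨s, hs⟩
    · exact hsame b x y ⟨∅, hQ, by simp⟩ ⟨∅, hQ, by simp⟩
    · exact hprev a b hab x hx s y (hσ s hs)
  rcases lt_trichotomy r r' with h | rfl | h
  · exact key h hv hv'
  · exact hsame r v v' hv hv'
  · exact (key h hv' hv).symm

/-- **Agreement from Rules 3 and 4.**
Suppose (i) within each register set, any two decided values are equal, and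
(ii) whenever `r < r'`, any value decided in register set `r` equals any
(non-nil) value contained in a register of register set `r'`. Quorums are
non-empty subsets of the servers. Then any two decided values are equal. -/
theorem agreement_across_register_sets
    {S V : Type*} [Fintype S]
    (𝒬 : ℕ → Set (Set S)) (σ : S → ℕ → Option (Option V))
    (hQne : ∀ r, ∀ Q ∈ 𝒬 r, Q.Nonempty)
    (hsame : ∀ r (v v' : V), Decided 𝒬 σ r v → Decided 𝒬 σ r v' → v = v')
    (hprev : ∀ r r', r < r' → ∀ (v : V), Decided 𝒬 σ r v →
      ∀ (s : S) (v' : V), σ s r' = some (some v') → v = v')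
    (r r' : ℕ) (v v' : V)
    (hv : Decided 𝒬 σ r v) (hv' : Decided 𝒬 σ r' v') :
    v = v' := by
  exact hv.agree hsame hprev hv'
end

section
/- Let σ₀, …, σ_N be an execution, r a register set, Q ∈ 𝒬 r a quorum and v a value. Then: (a) if for some index i the value v is not a possible decision of Q in register set r at σ_i, then v is not a possible decision of Q in register set r at σ_j for every j ≥ i; (b) if v is decided in register set r at σ_N via Q and, in case r is client-restricted, every server s with σ_N s r = some (some w) has w = v, then for every i ≤ N the value v is a possible decision of Q in register set r at σ_i. -/
/-- `Step σ σ' s r x`: a write-once step from `σ` to `σ'` writing `x` to the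
previously unwritten register `r` on server `s`, leaving all else unchanged. -/
def Step {S V : Type*} (σ σ' : S → ℕ → Option (Option V))
    (s : S) (r : ℕ) (x : Option V) : Prop :=
  σ s r = none ∧ σ' s r = some x ∧
    ∀ (s' : S) (r' : ℕ), ¬(s' = s ∧ r' = r) → σ' s' r' = σ s' r'

/-- `Possible CR σ r Q v`: the value `v` is a possible decision of the quorum
`Q` in register set `r` at state `σ`: every `s ∈ Q` has register `r` unwritten
or containing `v`, and moreover, if `r` is client-restricted (`CR r`), every
server with a non-nil value in register set `r` holds `v` there. -/
def Possible {S V : Type*} (CR : ℕ → Prop)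
    (σ : S → ℕ → Option (Option V)) (r : ℕ) (Q : Set S) (v : V) : Prop :=
  (∀ s ∈ Q, σ s r = none ∨ σ s r = some (some v)) ∧
  (CR r → ∀ (s : S) (w : V), σ s r = some (some w) → w = v)

/-- `Rule4 𝒬 CR σ r v`: a step writing the non-nil value `v` to register set
`r` satisfies Rule 4 at its pre-state `σ`: for every earlier register set
`r' < r`, every quorum `Q ∈ 𝒬 r'` and every value `v' ≠ v`, `v'` is not a
possible decision of `Q` in register set `r'` at `σ`. -/
def Rule4 {S V : Type*} (𝒬 : ℕ → Set (Set S)) (CR : ℕ → Prop)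
    (σ : S → ℕ → Option (Option V)) (r : ℕ) (v : V) : Prop :=
  ∀ r' < r, ∀ Q ∈ 𝒬 r', ∀ v' : V, v' ≠ v → ¬ Possible CR σ r' Q v'

/-- A written register keeps its content under a write-once step. -/
theorem Step.eq_some_of_eq_some {S V : Type*} {σ σ' : S → ℕ → Option (Option V)}
    {s : S} {r : ℕ} {x : Option V} (h : Step σ σ' s r x) {t : S} {q : ℕ} {y : Option V}
    (hy : σ t q = some y) : σ' t q = some y := by
  rw [h.2.2 t q, hy]
  rintro ⟨rfl, rfl⟩
  simp [h.1] at hy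

/-- A possible decision after a write-once step was already possible before it. -/
theorem Possible.of_step {S V : Type*} {CR : ℕ → Prop} {σ σ' : S → ℕ → Option (Option V)}
    {s : S} {q : ℕ} {x : Option V} (h : Step σ σ' s q x) {r : ℕ} {Q : Set S} {v : V}
    (hp : Possible CR σ' r Q v) : Possible CR σ r Q v := by
  refine ⟨fun t ht => ?_, fun hr t w hw => hp.2 hr t w (h.eq_some_of_eq_some hw)⟩
  rcases hσ : σ t r with _ | y
  · exact Or.inl rfl
  · simpa [h.eq_some_of_eq_some hσ] using hp.1 t ht

/-- Along a sequence of write-once steps, a possible decision was possible at every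
earlier state. -/
theorem Possible.of_le {S V : Type*} {CR : ℕ → Prop} {N : ℕ}
    {σ : ℕ → S → ℕ → Option (Option V)}
    (hstep : ∀ k < N, ∃ (s : S) (r : ℕ) (x : Option V), Step (σ k) (σ (k + 1)) s r x)
    {r : ℕ} {Q : Set S} {v : V} {i j : ℕ} (hij : i ≤ j) (hj : j ≤ N)
    (hp : Possible CR (σ j) r Q v) : Possible CR (σ i) r Q v := by
  induction j, hij using Nat.le_induction with
  | base => exact hp
  | succ j _ ih =>
    obtain ⟨s, q, x, h⟩ := hstep j hj
    exact ih (Nat.le_of_succ_le hj) (hp.of_step h)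

/-- **Monotonicity of possible decisions along an execution.**
Let `σ 0, …, σ N` be an execution (starting everywhere unwritten, each state
obtained from the previous by a write-once step), `r` a register set,
`Q ∈ 𝒬 r` a quorum and `v` a value. Then:
(a) once `v` is not a possible decision of `Q` in `r` at some `σ i`, it is not
a possible decision at `σ j` for any later `j`; and
(b) if `v` is decided in `r` at `σ N` via `Q` and, in case `r` is
client-restricted, every non-nil value in register set `r` at `σ N` is `v`,
then `v` is a possible decision of `Q` in `r` at every state of the execution. -/
theorem possible_decision_monotonicity
    {S V : Type*} [Fintype S]
    (𝒬 : ℕ → Set (Set S)) (CR : ℕ → Prop)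
    (N : ℕ) (σ : ℕ → S → ℕ → Option (Option V))
    (h0 : ∀ (s : S) (r : ℕ), σ 0 s r = none)
    (hstep : ∀ k < N, ∃ (s : S) (r : ℕ) (x : Option V), Step (σ k) (σ (k + 1)) s r x)
    (r : ℕ) (Q : Set S) (hQ : Q ∈ 𝒬 r) (v : V) :
    (∀ i ≤ N, ¬ Possible CR (σ i) r Q v →
      ∀ j, i ≤ j → j ≤ N → ¬ Possible CR (σ j) r Q v) ∧
    (((∀ s ∈ Q, σ N s r = some (some v)) ∧
        (CR r → ∀ (s : S) (w : V), σ N s r = some (some w) → w = v)) →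
      ∀ i ≤ N, Possible CR (σ i) r Q v) := by
  refine ⟨fun i _ hi j hij hj hp => hi (hp.of_le hstep hij hj), fun hd i hi => ?_⟩
  exact Possible.of_le hstep hi le_rfl ⟨fun s hs => Or.inr (hd.1 s hs), hd.2⟩
end

section
/- (Rule 4, base case.) Let σ₀, …, σ_N be an execution and suppose the value v is decided in register set r at σ_N via a quorum Q ∈ 𝒬 r, where, in case r is client-restricted, every server s with σ_N s r = some (some w) has w = v. Suppose step k writes a non-nil value v' to a register set r' > r, this step satisfies Rule 4 at its pre-state σ_{k-1}, and no step before step k wrote a non-nil value to any register set > r. Then v = v'. -/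
/-- A write-once step never changes a register that is already written. -/
theorem Step.written_eq {S V : Type*} {σ σ' : S → ℕ → Option (Option V)}
    {s : S} {r : ℕ} {x : Option V} (h : Step σ σ' s r x) {t : S} {i : ℕ} {y : Option V}
    (hy : σ t i = some y) : σ' t i = some y := by
  rw [h.2.2 t i, hy]
  rintro ⟨rfl, rfl⟩
  simp [h.1] at hy

/-- Along an execution, a written register keeps its contents. -/
theorem written_eq_of_le {S V : Type*} {N : ℕ} {σ : ℕ → S → ℕ → Option (Option V)}
    (hstep : ∀ k < N, ∃ (s : S) (r : ℕ) (x : Option V), Step (σ k) (σ (k + 1)) s r x)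
    {m n : ℕ} (hmn : m ≤ n) (hnN : n ≤ N) {t : S} {i : ℕ} {y : Option V}
    (hy : σ m t i = some y) : σ n t i = some y := by
  induction n, hmn using Nat.le_induction with
  | base => exact hy
  | succ n _ ih =>
    obtain ⟨s, r, x, h⟩ := hstep n hnN
    exact h.written_eq (ih (by omega))

/-- A decided value was a possible decision at every earlier state. -/
theorem possible_of_decided {S V : Type*} {CR : ℕ → Prop} {N : ℕ}
    {σ : ℕ → S → ℕ → Option (Option V)}
    (hstep : ∀ k < N, ∃ (s : S) (r : ℕ) (x : Option V), Step (σ k) (σ (k + 1)) s r x)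
    {r : ℕ} {Q : Set S} {v : V} (hdec : ∀ s ∈ Q, σ N s r = some (some v))
    (hcr : CR r → ∀ (s : S) (w : V), σ N s r = some (some w) → w = v)
    {m : ℕ} (hm : m ≤ N) : Possible CR (σ m) r Q v := by
  refine ⟨fun s hs => ?_, fun hr s w hw => hcr hr s w (written_eq_of_le hstep hm le_rfl hw)⟩
  cases hy : σ m s r with
  | none => exact Or.inl rfl
  | some y =>
    have := written_eq_of_le hstep hm le_rfl hy
    rw [hdec s hs] at this
    exact Or.inr this.symm

/-- **Rule 4, base case.**
Let `σ 0, …, σ N` be an execution. Suppose the value `v` is decided in register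
set `r` at `σ N` via the quorum `Q ∈ 𝒬 r`, where, in case `r` is
client-restricted, every non-nil value in register set `r` at `σ N` is `v`.
If step `k` (from `σ (k-1)` to `σ k`) writes a non-nil value `v'` to a register
set `r' > r`, satisfies Rule 4 at its pre-state `σ (k-1)`, and no earlier step
wrote a non-nil value to any register set `> r`, then `v = v'`. -/
theorem rule4_base_case
    {S V : Type*} [Fintype S]
    (𝒬 : ℕ → Set (Set S)) (CR : ℕ → Prop)
    (N : ℕ) (σ : ℕ → S → ℕ → Option (Option V))
    (h0 : ∀ (s : S) (r : ℕ), σ 0 s r = none)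
    (hstep : ∀ k < N, ∃ (s : S) (r : ℕ) (x : Option V), Step (σ k) (σ (k + 1)) s r x)
    (r : ℕ) (Q : Set S) (hQ : Q ∈ 𝒬 r) (v : V)
    (hdec : ∀ s ∈ Q, σ N s r = some (some v))
    (hcr : CR r → ∀ (s : S) (w : V), σ N s r = some (some w) → w = v)
    (k : ℕ) (hk1 : 1 ≤ k) (hkN : k ≤ N)
    (r' : ℕ) (hrr' : r < r') (v' : V)
    (hwrite : ∃ s : S, Step (σ (k - 1)) (σ k) s r' (some v'))
    (hrule4 : Rule4 𝒬 CR (σ (k - 1)) r' v')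
    (hfirst : ∀ j, 1 ≤ j → j < k → ∀ (s : S) (i : ℕ) (w : V), r < i →
      ¬ Step (σ (j - 1)) (σ j) s i (some w)) :
    v = v' := by
  by_contra hne
  exact hrule4 r hrr' Q hQ v hne (possible_of_decided hstep hdec hcr (by omega))
end

section
/- (Satisfying Rule 4.) Let σ₀, …, σ_N be an execution in which every write-once step that writes a non-nil value satisfies Rule 4 at its pre-state, and in which every step writing a non-nil value v to a client-restricted register set r has, at its pre-state σ, every server s with σ s r = some (some w) satisfying w = v. If the value v is decided in register set r at σ_N and σ_N s r' = some (some v') for some server s and some register set r' > r, then v = v'. -/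
/-- A written register keeps its content in all later states of an execution. -/
theorem register_persists {S V : Type*} {N : ℕ} {σ : ℕ → S → ℕ → Option (Option V)}
    (hstep : ∀ k < N, ∃ (s : S) (r : ℕ) (x : Option V), Step (σ k) (σ (k + 1)) s r x)
    {k n : ℕ} (hkn : k ≤ n) (hn : n ≤ N) {s : S} {r : ℕ} {x : Option V}
    (h : σ k s r = some x) : σ n s r = some x := by
  induction n, hkn using Nat.le_induction with
  | base => exact h
  | succ m _ ih =>
    obtain ⟨t, i, y, hnone, -, hother⟩ := hstep m hn
    have hm := ih (by omega)
    rw [hother s r, hm]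
    rintro ⟨rfl, rfl⟩
    simp [hm] at hnone

/-- Every written register of an execution was written by one of its steps. -/
theorem exists_step_of_written {S V : Type*} {N : ℕ} {σ : ℕ → S → ℕ → Option (Option V)}
    (h0 : ∀ (s : S) (r : ℕ), σ 0 s r = none)
    (hstep : ∀ k < N, ∃ (s : S) (r : ℕ) (x : Option V), Step (σ k) (σ (k + 1)) s r x)
    {n : ℕ} (hn : n ≤ N) {s : S} {r : ℕ} {x : Option V}
    (h : σ n s r = some x) : ∃ k < n, Step (σ k) (σ (k + 1)) s r x := by
  induction n with
  | zero => simp [h0] at h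
  | succ m ih =>
    obtain ⟨t, i, y, hst⟩ := hstep m hn
    by_cases hsr : s = t ∧ r = i
    · obtain ⟨rfl, rfl⟩ := hsr
      obtain rfl : y = x := by simpa [hst.2.1] using h
      exact ⟨m, m.lt_succ_self, hst⟩
    · rw [hst.2.2 s r hsr] at h
      obtain ⟨k, hk, hk'⟩ := ih (by omega) h
      exact ⟨k, by omega, hk'⟩

/-- All non-nil values in a client-restricted register set of an execution coincide. -/
theorem client_restricted_unique {S V : Type*} {CR : ℕ → Prop} {N : ℕ}
    {σ : ℕ → S → ℕ → Option (Option V)}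
    (h0 : ∀ (s : S) (r : ℕ), σ 0 s r = none)
    (hstep : ∀ k < N, ∃ (s : S) (r : ℕ) (x : Option V), Step (σ k) (σ (k + 1)) s r x)
    (hcr : ∀ k < N, ∀ (s : S) (i : ℕ) (w : V),
      Step (σ k) (σ (k + 1)) s i (some w) → CR i →
      ∀ (s' : S) (w' : V), σ k s' i = some (some w') → w' = w)
    {i : ℕ} (hi : CR i) {s t : S} {v w : V}
    (hs : σ N s i = some (some v)) (ht : σ N t i = some (some w)) : v = w := by
  obtain ⟨k, hk, hks⟩ := exists_step_of_written h0 hstep le_rfl hs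
  obtain ⟨l, hl, hlt⟩ := exists_step_of_written h0 hstep le_rfl ht
  rcases lt_trichotomy k l with h | rfl | h
  · exact hcr l hl t i w hlt hi s v (register_persists hstep h hl.le hks.2.1)
  · by_cases hst : s = t
    · subst hst
      simpa [hs] using ht
    · have hsame := hlt.2.2 s i fun h => hst h.1
      simp [hks.1, hks.2.1] at hsame
  · exact (hcr k hk s i v hks hi t w (register_persists hstep h hk.le hlt.2.1)).symm

/-- **Satisfying Rule 4.**
Let `σ 0, …, σ N` be an execution in which every write-once step that writes a
non-nil value satisfies Rule 4 at its pre-state, and in which every step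
writing a non-nil value `w` to a client-restricted register set `i` has, at its
pre-state, every non-nil value in register set `i` equal to `w`. Quorums are
non-empty subsets of servers. If the value `v` is decided in register set `r`
at `σ N` and `σ N s r' = some (some v')` for some server `s` and some register
set `r' > r`, then `v = v'`. -/
theorem satisfying_rule4
    {S V : Type*} [Fintype S]
    (𝒬 : ℕ → Set (Set S)) (CR : ℕ → Prop)
    (N : ℕ) (σ : ℕ → S → ℕ → Option (Option V))
    (hQne : ∀ i : ℕ, ∀ Q ∈ 𝒬 i, Q.Nonempty)
    (h0 : ∀ (s : S) (r : ℕ), σ 0 s r = none)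
    (hstep : ∀ k < N, ∃ (s : S) (r : ℕ) (x : Option V), Step (σ k) (σ (k + 1)) s r x)
    (hrule4 : ∀ k < N, ∀ (s : S) (i : ℕ) (w : V),
      Step (σ k) (σ (k + 1)) s i (some w) → Rule4 𝒬 CR (σ k) i w)
    (hrule3cr : ∀ k < N, ∀ (s : S) (i : ℕ) (w : V),
      Step (σ k) (σ (k + 1)) s i (some w) → CR i →
      ∀ (s' : S) (w' : V), σ k s' i = some (some w') → w' = w)
    (r : ℕ) (v : V) (hv : Decided 𝒬 (σ N) r v)
    (r' : ℕ) (hrr' : r < r') (s : S) (v' : V)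
    (hv' : σ N s r' = some (some v')) :
    v = v' := by
  by_contra hne
  obtain ⟨Q, hQ, hQv⟩ := hv
  obtain ⟨t, ht⟩ := hQne r Q hQ
  obtain ⟨k, hk, hks⟩ := exists_step_of_written h0 hstep le_rfl hv'
  refine hrule4 k hk s r' v' hks r hrr' Q hQ v hne ⟨fun q hq => ?_, fun hr q w hw => ?_⟩
  · rcases hx : σ k q r with _ | x
    · exact Or.inl rfl
    · have hxN := register_persists hstep hk.le le_rfl hx
      exact Or.inr (hxN.symm.trans (hQv q hq))
  · exact client_restricted_unique h0 hstep hrule3cr hr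
      (register_persists hstep hk.le le_rfl hw) (hQv t ht)
end

section
/- (Fast Paxos most-common-value lemma.) Let S be a finite set with n = |S| elements, V a type of values, f : S → Option V, and v a value such that 4·|{s ∈ S : f s = some v}| ≥ 3·n. Then for every M ⊆ S with 2·|M| > n and every value v' ≠ v, |{s ∈ M : f s = some v}| > |{s ∈ M : f s = some v'}|; that is, v is strictly the most common value of f among the servers of M. -/
/-- **Fast Paxos most-common-value lemma.**
Let `S` be a finite set, `f : α → Option V`, and `v` a value held (as `some v`)
by at least three quarters of `S`, i.e. `4|{s ∈ S : f s = some v}| ≥ 3|S|`.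
Then for every `M ⊆ S` with `2|M| > |S|` and every value `v' ≠ v`, strictly
more elements of `M` hold `v` than hold `v'`; that is, `v` is strictly the most
common value of `f` among the servers of `M`. -/
theorem fast_paxos_most_common_value
    {α V : Type*} [DecidableEq α] [DecidableEq V]
    (S : Finset α) (f : α → Option V) (v : V)
    (hv : 3 * S.card ≤ 4 * (S.filter (fun s => f s = some v)).card)
    (M : Finset α) (hM : M ⊆ S) (hMcard : S.card < 2 * M.card)
    (v' : V) (hne : v' ≠ v) :
    (M.filter (fun s => f s = some v')).card <
      (M.filter (fun s => f s = some v)).card := by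
  have hS := Finset.card_filter_add_card_filter_not (s := S) (fun s => f s = some v)
  have hM' := Finset.card_filter_add_card_filter_not (s := M) (fun s => f s = some v)
  have hnot : (M.filter (fun s => ¬ f s = some v)).card ≤
      (S.filter (fun s => ¬ f s = some v)).card :=
    Finset.card_le_card (Finset.filter_subset_filter _ hM)
  have hv' : (M.filter (fun s => f s = some v')).card ≤
      (M.filter (fun s => ¬ f s = some v)).card :=
    Finset.card_le_card (Finset.monotone_filter_right M fun s _ hs h =>
      hne (Option.some.inj (hs.symm.trans h)))
  omega
end

section
/- (Paxos value-selection lemma, classic case.) Let σ be a state, r < r' register sets, and Q, M ⊆ S with 2·|Q| > n and 2·|M| > n. Assume: (i) σ s r = some (some v) for every s ∈ Q; (ii) every non-nil value in register set r equals v (if σ s r = some (some w) then w = v); (iii) every non-nil value in a register set strictly between r and r' equals v (if r < i < r' and σ s i = some (some w) then w = v); and (iv) for every s ∈ M and every i < r', σ s i ≠ none. Then the set {i < r' : ∃ s ∈ M, ∃ w, σ s i = some (some w)} is nonempty, and its greatest element g satisfies r ≤ g < r' and: every s ∈ M with σ s g = some (some w) has w = v. In particular, the value read from the greatest non-nil register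 among the responses from M equals v. -/
/-- **Paxos value-selection lemma, classic case.**
Fix a finite set `S` of servers with `n = |S|` and a state
`σ : α → ℕ → Option (Option V)` (`none` unwritten, `some none` nil,
`some (some v)` value `v`). Let `r < r'` be register sets and `Q, M ⊆ S` with
`2|Q| > n` and `2|M| > n`. Assume: (i) every server of `Q` holds `v` in
register `r`; (ii) every non-nil value in register set `r` equals `v`;
(iii) every non-nil value in a register set strictly between `r` and `r'`
equals `v`; and (iv) every server of `M` has all registers below `r'` written.
Then the set `{i < r' : some server of M holds a non-nil value in register i}`
is non-empty, and its greatest element `g` satisfies `r ≤ g < r'` and every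
server of `M` holding a non-nil value `w` in register `g` has `w = v`. -/
theorem paxos_value_selection_classic
    {α V : Type*} [DecidableEq α]
    (S : Finset α) (σ : α → ℕ → Option (Option V))
    (r r' : ℕ) (hrr' : r < r')
    (Q M : Finset α) (hQ : Q ⊆ S) (hM : M ⊆ S)
    (hQcard : S.card < 2 * Q.card) (hMcard : S.card < 2 * M.card)
    (v : V)
    (h1 : ∀ s ∈ Q, σ s r = some (some v))
    (h2 : ∀ s ∈ S, ∀ w : V, σ s r = some (some w) → w = v)
    (h3 : ∀ i : ℕ, r < i → i < r' → ∀ s ∈ S, ∀ w : V, σ s i = some (some w) → w = v)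
    (h4 : ∀ s ∈ M, ∀ i < r', σ s i ≠ none) :
    {i : ℕ | i < r' ∧ ∃ s ∈ M, ∃ w : V, σ s i = some (some w)}.Nonempty ∧
    ∃ g : ℕ, IsGreatest {i : ℕ | i < r' ∧ ∃ s ∈ M, ∃ w : V, σ s i = some (some w)} g ∧
      r ≤ g ∧ g < r' ∧ ∀ s ∈ M, ∀ w : V, σ s g = some (some w) → w = v := by
  set A := {i : ℕ | i < r' ∧ ∃ s ∈ M, ∃ w : V, σ s i = some (some w)}
  obtain ⟨s, hs⟩ := Finset.inter_nonempty_of_card_lt_card_add_card hQ hM (by omega)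
  obtain ⟨hsQ, hsM⟩ := Finset.mem_inter.mp hs
  have hrA : r ∈ A := ⟨hrr', s, hsM, v, h1 s hsQ⟩
  have hbdd : BddAbove A := ⟨r', fun _ hi => hi.1.le⟩
  have hmem : sSup A ∈ A := Nat.sSup_mem ⟨r, hrA⟩ hbdd
  have hle : r ≤ sSup A := le_csSup hbdd hrA
  refine ⟨⟨r, hrA⟩, sSup A, ⟨hmem, fun _ hi => le_csSup hbdd hi⟩, hle, hmem.1, ?_⟩
  intro t ht w hw
  rcases hle.eq_or_lt with heq | hlt
  · exact h2 t (hM ht) w (heq ▸ hw)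
  · exact h3 _ hlt hmem.1 t (hM ht) w hw
end

section
/- (Fast Paxos value-selection lemma, fast case.) Let σ be a state, r < r' register sets, and Q, M ⊆ S with 4·|Q| ≥ 3·n and 2·|M| > n. Assume: (i) σ s r = some (some v) for every s ∈ Q; (ii) every non-nil value in a register set strictly between r and r' equals v (if r < i < r' and σ s i = some (some w) then w = v); and (iii) for every s ∈ M and every i < r', σ s i ≠ none. Then the set {i < r' : ∃ s ∈ M, ∃ w, σ s i = some (some w)} is nonempty, and its greatest element g satisfies r ≤ g < r' and: for every value v' ≠ v, |{s ∈ M : σ s g = some (some v)}| > |{s ∈ M : σ s g = some (some v')}|; that is, v is strictly the most common value at register set g among the responses from M. -/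
/-- **Fast Paxos value-selection lemma, fast case.**
Fix a finite set `S` of servers with `n = |S|` and a state
`σ : α → ℕ → Option (Option V)` (`none` unwritten, `some none` nil,
`some (some v)` value `v`). Let `r < r'` be register sets and `Q, M ⊆ S` with
`4|Q| ≥ 3n` and `2|M| > n`. Assume: (i) every server of `Q` holds `v` in
register `r`; (ii) every non-nil value in a register set strictly between `r`
and `r'` equals `v`; and (iii) every server of `M` has all registers below `r'`
written. Then the set `{i < r' : some server of M holds a non-nil value in
register i}` is non-empty, and its greatest element `g` satisfies `r ≤ g < r'`
and, for every value `v' ≠ v`, strictly more servers of `M` hold `v` than hold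
`v'` in register `g`; that is, `v` is strictly the most common value at
register set `g` among the responses from `M`. -/
theorem fast_paxos_value_selection_fast
    {α V : Type*} [DecidableEq α] [DecidableEq V]
    (S : Finset α) (σ : α → ℕ → Option (Option V))
    (r r' : ℕ) (hrr' : r < r')
    (Q M : Finset α) (hQ : Q ⊆ S) (hM : M ⊆ S)
    (hQcard : 3 * S.card ≤ 4 * Q.card) (hMcard : S.card < 2 * M.card)
    (v : V)
    (h1 : ∀ s ∈ Q, σ s r = some (some v))
    (h2 : ∀ i : ℕ, r < i → i < r' → ∀ s ∈ S, ∀ w : V, σ s i = some (some w) → w = v)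
    (h3 : ∀ s ∈ M, ∀ i < r', σ s i ≠ none) :
    {i : ℕ | i < r' ∧ ∃ s ∈ M, ∃ w : V, σ s i = some (some w)}.Nonempty ∧
    ∃ g : ℕ, IsGreatest {i : ℕ | i < r' ∧ ∃ s ∈ M, ∃ w : V, σ s i = some (some w)} g ∧
      r ≤ g ∧ g < r' ∧
      ∀ v' : V, v' ≠ v →
        (M.filter (fun s => σ s g = some (some v'))).card <
          (M.filter (fun s => σ s g = some (some v))).card := by
  have hcard : (M \ Q).card < (M ∩ Q).card := by
    have hsplit := Finset.card_sdiff_add_card_inter M Q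
    have hle : (M \ Q).card ≤ (S \ Q).card :=
      Finset.card_le_card (Finset.sdiff_subset_sdiff hM (Finset.Subset.refl Q))
    have hS := Finset.card_sdiff_add_card_eq_card hQ
    omega
  obtain ⟨q, hq⟩ := Finset.card_pos.mp (Nat.zero_lt_of_lt hcard)
  rw [Finset.mem_inter] at hq
  set A := {i : ℕ | i < r' ∧ ∃ s ∈ M, ∃ w : V, σ s i = some (some w)}
  have hrA : r ∈ A := ⟨hrr', q, hq.1, v, h1 q hq.2⟩
  have hbdd : BddAbove A := ⟨r', fun i hi => hi.1.le⟩
  have hmem : sSup A ∈ A := Nat.sSup_mem ⟨r, hrA⟩ hbdd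
  have hgreatest : IsGreatest A (sSup A) := ⟨hmem, fun i hi => le_csSup hbdd hi⟩
  refine ⟨⟨r, hrA⟩, sSup A, hgreatest, hgreatest.2 hrA, hmem.1, fun v' hv' => ?_⟩
  rcases (hgreatest.2 hrA).eq_or_lt with hr | hr
  · rw [← hr]
    calc
      (M.filter (fun s => σ s r = some (some v'))).card ≤ (M \ Q).card := by
        refine Finset.card_le_card fun s hs => ?_
        rw [Finset.mem_filter] at hs
        refine Finset.mem_sdiff.mpr ⟨hs.1, fun hsQ => hv' ?_⟩
        simpa [h1 s hsQ] using hs.2.symm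
      _ < (M ∩ Q).card := hcard
      _ ≤ (M.filter (fun s => σ s r = some (some v))).card := by
        refine Finset.card_le_card fun s hs => ?_
        rw [Finset.mem_inter] at hs
        exact Finset.mem_filter.mpr ⟨hs.1, h1 s hs.2⟩
  · obtain ⟨hlt, s, hs, w, hw⟩ := hmem
    obtain rfl := h2 _ hr hlt s (hM hs) w hw
    rw [Finset.filter_eq_empty_iff.mpr fun t ht h => hv' (h2 _ hr hlt t (hM ht) v' h),
      Finset.card_empty, Finset.card_pos]
    exact ⟨s, Finset.mem_filter.mpr ⟨hs, hw⟩⟩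
end
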